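/- Let Λ ⊆ (0,∞), ω₀ ∈ M_Λ and r > 0. Then the closed ball {ω ∈ M_Λ : d(ω, ω₀) ≤ r}, with the induced metric, is isometric to M_{Λ ∩ (0,r]}, and the open ball {ω ∈ M_Λ : d(ω, ω₀) < r}, with the induced metric, is isometric to M_{Λ ∩ (0,r)}. -/

import Mathlib

/-- The model `M_Λ` of the ultrametric Urysohn space: functions `ω : Λ → ℤ` such that for
every `ε > 0` the set of `λ ∈ Λ` with `λ ≥ ε` and `ω(λ) ≠ 0` is finite. -/
abbrev UrysohnPt (Λ : Set ℝ) : Type :=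
  {ω : Λ → ℤ // ∀ ε : ℝ, 0 < ε → {l : Λ | ε ≤ (l : ℝ) ∧ ω l ≠ 0}.Finite}

/-- The distance on `M_Λ`: the largest `λ ∈ Λ` at which the two functions differ
(`sSup ∅ = 0` in Mathlib, so `uDist ω ω = 0`). -/
noncomputable def uDist {Λ : Set ℝ} (ω ω' : UrysohnPt Λ) : ℝ :=
  sSup ((fun l : Λ => (l : ℝ)) '' {l : Λ | ω.1 l ≠ ω'.1 l})

namespace UrysohnPt

variable {Λ : Set ℝ}

/-- The places where two points of `M_Λ` differ are bounded by `ε` or by one of these places. -/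
theorem exists_bound_ne (ω ω' : UrysohnPt Λ) {ε : ℝ} (hε : 0 < ε) :
    ∃ m : ℝ, ε ≤ m ∧ (m = ε ∨ ∃ l : Λ, ω.1 l ≠ ω'.1 l ∧ (l : ℝ) = m) ∧
      ∀ l : Λ, ω.1 l ≠ ω'.1 l → (l : ℝ) ≤ m := by
  have hfin : {l : Λ | ε ≤ (l : ℝ) ∧ ω.1 l ≠ ω'.1 l}.Finite := by
    refine ((ω.2 ε hε).union (ω'.2 ε hε)).subset fun l hl => ?_
    by_cases h : ω.1 l = 0
    · exact Or.inr ⟨hl.1, fun h' => hl.2 (h.trans h'.symm)⟩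
    · exact Or.inl ⟨hl.1, h⟩
  obtain ⟨m, hm, hmax⟩ := Set.exists_max_image _ id
    ((hfin.image fun l : Λ => (l : ℝ)).insert ε) (Set.insert_nonempty _ _)
  have hεm : ε ≤ m := hmax ε (Set.mem_insert _ _)
  refine ⟨m, hεm, ?_, fun l hl => ?_⟩
  · rcases hm with rfl | ⟨l, hl, rfl⟩
    · exact Or.inl rfl
    · exact Or.inr ⟨l, hl.2, rfl⟩
  · rcases le_total ε l with h | h
    · exact hmax _ (Set.mem_insert_of_mem _ ⟨l, ⟨h, hl⟩, rfl⟩)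
    · exact h.trans hεm

theorem le_uDist {ω ω' : UrysohnPt Λ} {l : Λ} (h : ω.1 l ≠ ω'.1 l) : (l : ℝ) ≤ uDist ω ω' := by
  obtain ⟨m, -, -, hm⟩ := exists_bound_ne ω ω' one_pos
  refine le_csSup ⟨m, ?_⟩ ⟨l, h, rfl⟩
  rintro _ ⟨k, hk, rfl⟩
  exact hm k hk

theorem uDist_le {ω ω' : UrysohnPt Λ} {m : ℝ} (hm : 0 ≤ m)
    (h : ∀ l : Λ, ω.1 l ≠ ω'.1 l → (l : ℝ) ≤ m) : uDist ω ω' ≤ m := by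
  refine Real.sSup_le ?_ hm
  rintro _ ⟨l, hl, rfl⟩
  exact h l hl

theorem uDist_le_iff {ω ω' : UrysohnPt Λ} {r : ℝ} (hr : 0 < r) :
    uDist ω ω' ≤ r ↔ ∀ l : Λ, ω.1 l ≠ ω'.1 l → (l : ℝ) ≤ r :=
  ⟨fun h _ hl => (le_uDist hl).trans h, uDist_le hr.le⟩

theorem uDist_lt_iff {ω ω' : UrysohnPt Λ} {r : ℝ} (hr : 0 < r) :
    uDist ω ω' < r ↔ ∀ l : Λ, ω.1 l ≠ ω'.1 l → (l : ℝ) < r := by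
  refine ⟨fun h _ hl => (le_uDist hl).trans_lt h, fun h => ?_⟩
  obtain ⟨m, hm₀, hm, hle⟩ := exists_bound_ne ω ω' (half_pos hr)
  refine (uDist_le ((half_pos hr).le.trans hm₀) hle).trans_lt ?_
  rcases hm with rfl | ⟨l, hl, rfl⟩
  · exact half_lt_self hr
  · exact h l hl

/-- Restriction of a point of `M_Λ` to `Λ ∩ T`. -/
def restrict (T : Set ℝ) (ω : UrysohnPt Λ) : UrysohnPt (Λ ∩ T) :=
  ⟨fun l => ω.1 ⟨l, l.2.1⟩, fun ε hε =>
    (ω.2 ε hε).preimage (f := fun l : ↥(Λ ∩ T) => (⟨l, l.2.1⟩ : Λ))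
      (Set.inclusion_injective Set.inter_subset_left).injOn⟩

open Classical in
/-- The point of `M_Λ` which is `η` on `Λ ∩ T` and `ω₀` elsewhere. -/
noncomputable def extend {T : Set ℝ} (ω₀ : UrysohnPt Λ) (η : UrysohnPt (Λ ∩ T)) : UrysohnPt Λ :=
  ⟨fun l => if h : (l : ℝ) ∈ T then η.1 ⟨l, l.2, h⟩ else ω₀.1 l, fun ε hε => by
    refine (((η.2 ε hε).image (Set.inclusion Set.inter_subset_left)).union
      (ω₀.2 ε hε)).subset fun l hl => ?_
    obtain ⟨hl₁, hl₂⟩ := hl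
    by_cases h : (l : ℝ) ∈ T
    · exact Or.inl ⟨⟨l, l.2, h⟩, ⟨hl₁, fun h₀ => hl₂ ((dif_pos h).trans h₀)⟩, rfl⟩
    · exact Or.inr ⟨hl₁, fun h₀ => hl₂ ((dif_neg h).trans h₀)⟩⟩

/-- Restriction to `Λ ∩ T` is an isometry on the points which agree with `ω₀` off `T`. -/
theorem restrict_bijective_isometry (T : Set ℝ) (ω₀ : UrysohnPt Λ) {p : UrysohnPt Λ → Prop}
    (hp : ∀ ω, p ω ↔ ∀ l : Λ, ω.1 l ≠ ω₀.1 l → (l : ℝ) ∈ T) :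
    ∃ f : {ω : UrysohnPt Λ // p ω} → UrysohnPt (Λ ∩ T),
      Function.Bijective f ∧
      ∀ a b : {ω : UrysohnPt Λ // p ω}, uDist (f a) (f b) = uDist a.1 b.1 := by
  have hmem : ∀ (a b : {ω : UrysohnPt Λ // p ω}) (l : Λ), a.1.1 l ≠ b.1.1 l → (l : ℝ) ∈ T := by
    intro a b l hl
    by_contra hT
    have ha := not_imp_comm.1 ((hp _).1 a.2 l) hT
    have hb := not_imp_comm.1 ((hp _).1 b.2 l) hT
    exact hl (ha.trans hb.symm)
  refine ⟨fun a => restrict T a.1, ⟨fun a b hab => ?_, fun η => ?_⟩, fun a b => ?_⟩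
  · refine Subtype.ext (Subtype.ext (funext fun l => ?_))
    by_contra hl
    exact hl (congrFun (congrArg Subtype.val hab) ⟨l, l.2, hmem a b l hl⟩)
  · refine ⟨⟨extend ω₀ η, (hp _).2 fun l hl => ?_⟩, Subtype.ext (funext fun l => ?_)⟩
    · by_contra hT
      exact hl (dif_neg hT)
    · exact dif_pos l.2.2
  · refine congrArg sSup (Set.ext fun x => ⟨?_, ?_⟩)
    · rintro ⟨l, hl, rfl⟩
      exact ⟨⟨l, l.2.1⟩, hl, rfl⟩
    · rintro ⟨l, hl, rfl⟩
      exact ⟨⟨l, l.2, hmem a b l hl⟩, hl, rfl⟩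

end UrysohnPt

/-- Balls in the ultrametric Urysohn space: the closed ball of radius `r > 0` in `M_Λ` is
isometric to `M_{Λ ∩ (0,r]}`, and the open ball of radius `r` is isometric to
`M_{Λ ∩ (0,r)}`. -/
theorem urysohnSpace_balls_isometric
    (Λ : Set ℝ) (hΛ : ∀ t ∈ Λ, 0 < t) (ω₀ : UrysohnPt Λ) (r : ℝ) (hr : 0 < r) :
    (∃ f : {ω : UrysohnPt Λ // uDist ω ω₀ ≤ r} → UrysohnPt (Λ ∩ Set.Ioc 0 r),
      Function.Bijective f ∧
      ∀ a b : {ω : UrysohnPt Λ // uDist ω ω₀ ≤ r}, uDist (f a) (f b) = uDist a.1 b.1) ∧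
    (∃ g : {ω : UrysohnPt Λ // uDist ω ω₀ < r} → UrysohnPt (Λ ∩ Set.Ioo 0 r),
      Function.Bijective g ∧
      ∀ a b : {ω : UrysohnPt Λ // uDist ω ω₀ < r}, uDist (g a) (g b) = uDist a.1 b.1) := by
  exact
    ⟨UrysohnPt.restrict_bijective_isometry _ ω₀ fun ω => (UrysohnPt.uDist_le_iff hr).trans
      (forall₂_congr fun l _ => (and_iff_right (hΛ l l.2)).symm),
    UrysohnPt.restrict_bijective_isometry _ ω₀ fun ω => (UrysohnPt.uDist_lt_iff hr).trans
      (forall₂_congr fun l _ => (and_iff_right (hΛ l l.2)).symm)⟩
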